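/- (Pointwise form of Bolsinov's completeness criterion for pencils of skew forms.) Let V be a finite-dimensional complex vector space and let A, B be alternating (skew-symmetric) bilinear forms on V. Set r = max_{(λ,μ) ∈ ℂ²} rank(λA + μB), where the rank of a bilinear form is the rank of the induced linear map V → V*. Let L ⊆ V be the linear span of the union of the kernels ker(λA + μB) over all (λ,μ) ∈ ℂ² with rank(λA + μB) = r. Then dim L = dim V − r/2 if and only if rank(λA + μB) = r for every (λ,μ) ∈ ℂ² with (λ,μ) ≠ (0,0). -/

import Mathlib

open Module

namespace Bols

variable {V : Type*} [AddCommGroup V] [Module ℂ V]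

/-- The form of the pencil with parameter `c`. -/
abbrev P (A B : V →ₗ[ℂ] V →ₗ[ℂ] ℂ) (c : ℂ × ℂ) : V →ₗ[ℂ] V →ₗ[ℂ] ℂ := c.1 • A + c.2 • B

/-- The determinant of a pair of parameters. -/
def dt (c d : ℂ × ℂ) : ℂ := c.1 * d.2 - c.2 * d.1

/-- The span of kernels of regular forms, avoiding the directions in `F`. -/
def LF (A B : V →ₗ[ℂ] V →ₗ[ℂ] ℂ) (r : ℕ) (F : Finset (ℂ × ℂ)) : Submodule ℂ V :=
  ⨆ (c : ℂ × ℂ) (_ : finrank ℂ (LinearMap.range (P A B c)) = r ∧ ∀ d ∈ F, dt c d ≠ 0),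
    LinearMap.ker (P A B c)

/-- Regular forms are generic on lines. -/
theorem finite_bad [FiniteDimensional ℂ V] (A B : V →ₗ[ℂ] V →ₗ[ℂ] ℂ) (r : ℕ)
    (h : finrank ℂ (LinearMap.range A) = r) :
    {t : ℂ | finrank ℂ (LinearMap.range (A + t • B)) < r}.Finite := by
  classical
  obtain ⟨W, hW⟩ := Submodule.exists_isCompl (LinearMap.ker A)
  have hinj : Function.Injective (A ∘ₗ W.subtype) := by
    rw [← LinearMap.ker_eq_bot, LinearMap.ker_comp]
    exact Submodule.disjoint_iff_comap_eq_bot.mp hW.symm.disjoint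
  have hWr : finrank ℂ W = r := by
    have h1 := Submodule.finrank_add_eq_of_isCompl hW
    have h2 := LinearMap.finrank_range_add_finrank_ker A
    omega
  let g : (V →ₗ[ℂ] ℂ) →ₗ[ℂ] W := (LinearMap.exists_leftInverse_of_injective (A ∘ₗ W.subtype)
    (LinearMap.ker_eq_bot.mpr hinj)).choose
  have hg : g ∘ₗ (A ∘ₗ W.subtype) = LinearMap.id :=
    (LinearMap.exists_leftInverse_of_injective (A ∘ₗ W.subtype)
    (LinearMap.ker_eq_bot.mpr hinj)).choose_spec
  let T : W →ₗ[ℂ] W := g ∘ₗ (B ∘ₗ W.subtype)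
  have hT : ∀ t : ℂ, g ∘ₗ ((A + t • B) ∘ₗ W.subtype) = LinearMap.id + t • T := by
    intro t
    rw [← hg]
    ext x
    simp [T]
  have hfin : {t : ℂ | Module.End.HasEigenvalue T t}.Finite :=
    Module.End.finite_hasEigenvalue T
  refine (hfin.image (fun s => - s⁻¹)).subset ?_
  intro t ht
  have hnot : ¬ Function.Injective (LinearMap.id + t • T : W →ₗ[ℂ] W) := by
    intro hi
    rw [← hT t] at hi
    have h3 : Function.Injective ((A + t • B) ∘ₗ W.subtype) := by
      rw [LinearMap.coe_comp] at hi
      exact hi.of_comp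
    have h4 := LinearMap.finrank_range_of_inj h3
    have h5 := Submodule.finrank_mono (LinearMap.range_comp_le_range W.subtype (A + t • B))
    have : finrank ℂ (LinearMap.range (A + t • B)) < r := ht
    omega
  rw [← LinearMap.ker_eq_bot, Submodule.eq_bot_iff] at hnot
  push Not at hnot
  obtain ⟨x, hx, hx0⟩ := hnot
  have hx' : x + t • T x = 0 := by simpa using hx
  have ht0 : t ≠ 0 := by
    rintro rfl
    simp at hx'
    exact hx0 hx'
  refine ⟨-t⁻¹, ?_, by simp⟩
  refine Module.End.hasEigenvalue_of_hasEigenvector (x := x) ⟨?_, hx0⟩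
  rw [Module.End.mem_eigenspace_iff]
  have : t • T x = -x := by
    rw [eq_neg_iff_add_eq_zero, add_comm]; exact hx'
  calc T x = t⁻¹ • (t • T x) := by rw [smul_smul, inv_mul_cancel₀ ht0, one_smul]
    _ = (-t⁻¹) • x := by rw [this, smul_neg, neg_smul]

theorem exists_reg [FiniteDimensional ℂ V] (A B : V →ₗ[ℂ] V →ₗ[ℂ] ℂ) (r : ℕ)
    (hr : ∀ c, finrank ℂ (LinearMap.range (P A B c)) ≤ r)
    (a : ℂ × ℂ) (ha : finrank ℂ (LinearMap.range (P A B a)) = r) (ha0 : a ≠ 0)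
    (F : Finset (ℂ × ℂ)) (hF : ∀ d ∈ F, d ≠ 0) :
    ∃ c, finrank ℂ (LinearMap.range (P A B c)) = r ∧ ∀ d ∈ F, dt c d ≠ 0 := by
  obtain ⟨b, hb⟩ : ∃ b, dt a b ≠ 0 := by
    by_cases h : a.1 = 0
    · refine ⟨(1, 0), ?_⟩
      have : a.2 ≠ 0 := fun h2 => ha0 (Prod.ext h h2)
      simpa [dt] using this
    · exact ⟨(0, 1), by simpa [dt] using h⟩
  have h1 := finite_bad (P A B a) (P A B b) r ha
  have h2 : (⋃ d ∈ F, {t : ℂ | dt (a + t • b) d = 0}).Finite := by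
    refine Set.Finite.biUnion F.finite_toSet ?_
    intro d hd
    refine Set.Subsingleton.finite ?_
    intro s hs t ht
    simp only [dt, Set.mem_ofPred_eq, Prod.fst_add, Prod.snd_add, Prod.smul_fst, Prod.smul_snd,
      smul_eq_mul] at hs ht
    by_contra hst
    have hst' : s - t ≠ 0 := sub_ne_zero.mpr hst
    have e1 : b.1 * d.2 - b.2 * d.1 = 0 := by
      have : (s - t) * (b.1 * d.2 - b.2 * d.1) = 0 := by linear_combination hs - ht
      exact (mul_eq_zero.mp this).resolve_left hst'
    have e2 : a.1 * d.2 - a.2 * d.1 = 0 := by linear_combination hs - s * e1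
    apply hF d hd
    apply Prod.ext
    · have : dt a b * d.1 = 0 := by
        simp only [dt]; linear_combination b.1 * e2 - a.1 * e1
      exact (mul_eq_zero.mp this).resolve_left hb
    · have : dt a b * d.2 = 0 := by
        simp only [dt]; linear_combination b.2 * e2 - a.2 * e1
      exact (mul_eq_zero.mp this).resolve_left hb
  obtain ⟨t, ht⟩ := (h1.union h2).exists_notMem
  refine ⟨a + t • b, ?_, ?_⟩
  · have h3 : P A B (a + t • b) = P A B a + t • P A B b := by
      ext x y; simp [P]; ring
    have h4 : ¬ finrank ℂ (LinearMap.range (P A B a + t • P A B b)) < r :=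
      fun h => ht (Or.inl h)
    have h5 := hr (a + t • b)
    rw [h3] at h5 ⊢
    omega
  · intro d hd h
    apply ht
    right
    simp only [Set.mem_iUnion]
    exact ⟨d, hd, h⟩

theorem comb (A B : V →ₗ[ℂ] V →ₗ[ℂ] ℂ) (c d e : ℂ × ℂ) (h : dt e d ≠ 0) :
    P A B c = (dt c d / dt e d) • P A B e + (dt e c / dt e d) • P A B d := by
  have h1 : c.1 = (dt c d / dt e d) * e.1 + (dt e c / dt e d) * d.1 := by
    field_simp; simp only [dt]; ring
  have h2 : c.2 = (dt c d / dt e d) * e.2 + (dt e c / dt e d) * d.2 := by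
    field_simp; simp only [dt]; ring
  ext x y
  simp only [P, LinearMap.add_apply, LinearMap.smul_apply, smul_eq_mul]
  linear_combination (A x y) * h1 + (B x y) * h2

theorem main [FiniteDimensional ℂ V] (A B : V →ₗ[ℂ] V →ₗ[ℂ] ℂ)
    (hA : ∀ v : V, A v v = 0) (hB : ∀ v : V, B v v = 0) (r : ℕ) (hr0 : r ≠ 0)
    (hr : ∀ c, finrank ℂ (LinearMap.range (P A B c)) ≤ r)
    (hex : ∃ c, finrank ℂ (LinearMap.range (P A B c)) = r)
    (L : Submodule ℂ V)
    (hL : L = ⨆ (c : ℂ × ℂ) (_ : finrank ℂ (LinearMap.range (P A B c)) = r),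
        LinearMap.ker (P A B c)) :
    (2 * finrank ℂ L + r = 2 * finrank ℂ V) ↔
      (∀ c, c ≠ 0 → finrank ℂ (LinearMap.range (P A B c)) = r) := by
  classical
  have hreg0 : ∀ c, finrank ℂ (LinearMap.range (P A B c)) = r → c ≠ 0 := by
    rintro c hc rfl
    apply hr0
    rw [← hc]
    simp [P]
  have hskew : ∀ c x y, P A B c x y = - P A B c y x := by
    intro c x y
    have h : ∀ v, P A B c v v = 0 := fun v => by simp [P, hA, hB]
    have := h (x + y)
    have hx := h x
    have hy := h y
    simp only [P, map_add, LinearMap.add_apply, LinearMap.smul_apply, smul_eq_mul]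
      at this hx hy ⊢
    linear_combination this - hx - hy
  obtain ⟨a, ha⟩ := hex
  have ha0 := hreg0 a ha
  -- choose F minimizing
  obtain ⟨F, hF, hmin⟩ : ∃ F : Finset (ℂ × ℂ), (∀ d ∈ F, d ≠ 0) ∧
      ∀ G : Finset (ℂ × ℂ), (∀ d ∈ G, d ≠ 0) →
        finrank ℂ (LF A B r F) ≤ finrank ℂ (LF A B r G) := by
    let S : Set (Finset (ℂ × ℂ)) := {F | ∀ d ∈ F, d ≠ 0}
    have hS : S.Nonempty := ⟨∅, by simp [S]⟩
    let f : Finset (ℂ × ℂ) → ℕ := fun F => finrank ℂ (LF A B r F)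
    exact ⟨Function.argminOn f S hS, Function.argminOn_mem f S hS,
      fun G hG => Function.argminOn_le f S hG⟩
  have hins : ∀ d, d ≠ 0 → LF A B r F = LF A B r (insert d F) := by
    intro d hd
    symm
    apply Submodule.eq_of_le_of_finrank_le
    · refine iSup_le fun c => iSup_le fun hc => ?_
      exact le_iSup₂_of_le c ⟨hc.1, fun d hd => hc.2 d (Finset.mem_insert_of_mem hd)⟩ le_rfl
    · apply hmin
      intro e he
      rcases Finset.mem_insert.mp he with rfl | he
      · exact hd
      · exact hF e he
  have hmap : ∀ c d, d ≠ 0 → (LF A B r F).map (P A B c) ≤ (LF A B r F).map (P A B d) := by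
    intro c d hd
    conv_lhs => rw [hins d hd]
    rw [Submodule.map_le_iff_le_comap]
    refine iSup_le fun e => iSup_le fun he => ?_
    intro u hu
    have hde := he.2 d (Finset.mem_insert_self d F)
    refine ⟨(dt e c / dt e d) • u, ?_, ?_⟩
    · refine Submodule.smul_mem _ _ ?_
      exact (le_iSup₂_of_le (f := fun (c : ℂ × ℂ) (_ : finrank ℂ (LinearMap.range (P A B c)) = r ∧
        ∀ d ∈ F, dt c d ≠ 0) => LinearMap.ker (P A B c)) e
        ⟨he.1, fun d hd => he.2 d (Finset.mem_insert_of_mem hd)⟩ le_rfl) hu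
    · have h1 : P A B c u = (dt c d / dt e d) • P A B e u + (dt e c / dt e d) • P A B d u := by
        rw [comb A B c d e hde]; rfl
      rw [h1, LinearMap.mem_ker.mp hu, map_smul, smul_zero, zero_add]
  have hmapeq : ∀ c d, c ≠ 0 → d ≠ 0 →
      (LF A B r F).map (P A B c) = (LF A B r F).map (P A B d) :=
    fun c d hc hd => le_antisymm (hmap c d hd) (hmap d c hc)
  have hdim : ∀ (c : ℂ × ℂ) (N : Submodule ℂ V), finrank ℂ (N.map (P A B c)) +
      finrank ℂ (LinearMap.ker (P A B c) ⊓ N : Submodule ℂ V) = finrank ℂ N := by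
    intro c N
    have h1 := LinearMap.finrank_range_add_finrank_ker ((P A B c).domRestrict N)
    have h2 : LinearMap.range ((P A B c).domRestrict N) = N.map (P A B c) :=
      LinearMap.range_domRestrict _ _
    have h3 : finrank ℂ (LinearMap.ker ((P A B c).domRestrict N)) =
        finrank ℂ (LinearMap.ker (P A B c) ⊓ N : Submodule ℂ V) := by
      rw [← Submodule.finrank_map_subtype_eq N (LinearMap.ker ((P A B c).domRestrict N))]
      suffices h : (LinearMap.ker ((P A B c).domRestrict N)).map N.subtype =
          LinearMap.ker (P A B c) ⊓ N by rw [h]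
      ext x
      constructor
      · rintro ⟨y, hy, rfl⟩
        exact ⟨hy, y.2⟩
      · rintro ⟨h4, h5⟩
        exact ⟨⟨x, h5⟩, h4, rfl⟩
    rw [h2, h3] at h1
    exact h1
  have hrk := fun c => LinearMap.finrank_range_add_finrank_ker (P A B c)
  obtain ⟨e, her, heF⟩ := exists_reg A B r hr a ha ha0 F hF
  have he0 := hreg0 e her
  have heker : LinearMap.ker (P A B e) ≤ LF A B r F :=
    le_iSup₂_of_le (f := fun (c : ℂ × ℂ) (_ : finrank ℂ (LinearMap.range (P A B c)) = r ∧
        ∀ d ∈ F, dt c d ≠ 0) => LinearMap.ker (P A B c)) e ⟨her, heF⟩ le_rfl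
  have hkd : ∀ c, c ≠ 0 →
      finrank ℂ (LinearMap.ker (P A B c) ⊓ LF A B r F : Submodule ℂ V) + r = finrank ℂ V := by
    intro c hc
    have h1 := hdim c (LF A B r F)
    have h2 := hdim e (LF A B r F)
    rw [inf_eq_left.mpr heker] at h2
    rw [hmapeq c e hc he0] at h1
    have := hrk e
    omega
  have hker : ∀ c, finrank ℂ (LinearMap.range (P A B c)) = r →
      LinearMap.ker (P A B c) ≤ LF A B r F := by
    intro c hc
    have h1 := hkd c (hreg0 c hc)
    have h2 := hrk c
    rw [← inf_eq_left]
    exact Submodule.eq_of_le_of_finrank_le inf_le_left (by omega)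
  have hLL : LF A B r F = L := by
    rw [hL]
    apply le_antisymm
    · refine iSup_le fun c => iSup_le fun hc => ?_
      exact le_iSup₂_of_le c hc.1 le_rfl
    · exact iSup_le fun c => iSup_le fun hc => hker c hc
  have hiso : ∀ c, ∀ x ∈ L, ∀ y ∈ L, P A B c x y = 0 := by
    intro c x hx y hy
    have h1 : L ≤ LinearMap.ker ((P A B c).flip y) := by
      rw [← hLL]
      refine iSup_le fun e => iSup_le fun he => ?_
      intro x hx
      have he0 := hreg0 e he.1
      rw [LinearMap.mem_ker, LinearMap.flip_apply]
      have h2 : L ≤ LinearMap.ker (P A B c x) := by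
        rw [← hLL, hins e he0]
        refine iSup_le fun f => iSup_le fun hf => ?_
        intro y hy
        have hfe := hf.2 e (Finset.mem_insert_self e F)
        rw [LinearMap.mem_ker, comb A B c e f hfe, LinearMap.add_apply, LinearMap.smul_apply,
          LinearMap.smul_apply, LinearMap.mem_ker.mp hx, LinearMap.add_apply,
          LinearMap.smul_apply, hskew f x y, LinearMap.mem_ker.mp hy]
        simp
      exact h2 hy
    exact h1 hx
  rw [hLL] at hmapeq hkd
  have hann : ∀ c, L.map (P A B c) ≤ L.dualAnnihilator := by
    rintro c _ ⟨x, hx, rfl⟩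
    rw [Submodule.mem_dualAnnihilator]
    exact fun y hy => hiso c x hx y hy
  have hannd : finrank ℂ L + finrank ℂ L.dualAnnihilator = finrank ℂ V :=
    Subspace.finrank_add_finrank_dualAnnihilator_eq L
  constructor
  · intro hdimL c hc
    have h1 := hkd c hc
    have h2 := hdim c L
    have h3 : L.map (P A B c) = L.dualAnnihilator :=
      Submodule.eq_of_le_of_finrank_le (hann c) (by
        have h5 : finrank ℂ L.dualAnnihilator = finrank ℂ V - finrank ℂ L := by omega
        have h6 : finrank ℂ V - finrank ℂ L ≤ finrank ℂ (L.map (P A B c)) := by omega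
        exact h5.le.trans h6)
    have h4 : LinearMap.ker (P A B c) ≤ L := by
      intro x hx
      rw [← Subspace.dualAnnihilator_dualCoannihilator_eq (W := L), ← h3,
        Submodule.mem_dualCoannihilator]
      rintro _ ⟨y, hy, rfl⟩
      rw [hskew, LinearMap.mem_ker.mp hx]
      simp
    rw [inf_eq_left.mpr h4] at h1
    have := hrk c
    omega
  · intro hall
    set D := L.map (P A B e) with hD
    set M := D.dualCoannihilator with hM
    have hLM : L ≤ M := by
      intro x hx
      rw [hM, Submodule.mem_dualCoannihilator]
      rintro _ ⟨y, hy, rfl⟩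
      exact hiso e y hy x hx
    have hDM : M.dualAnnihilator = D := Subspace.dualCoannihilator_dualAnnihilator_eq
    have hkey : ∀ c, c ≠ 0 → ∀ x ∈ M, (∀ y ∈ M, P A B c x y = 0) → x ∈ L := by
      intro c hc x _ hx
      have h1 : P A B c x ∈ M.dualAnnihilator := by
        rw [Submodule.mem_dualAnnihilator]; exact hx
      rw [hDM, hD, hmapeq e c he0 hc] at h1
      obtain ⟨y, hy, hyx⟩ := h1
      have h2 : x - y ∈ L := by
        rw [← hLL]
        apply hker c (hall c hc)
        rw [LinearMap.mem_ker, map_sub, hyx, sub_self]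
      simpa using L.add_mem h2 hy
    have hMperp : ∀ c, c ≠ 0 → ∀ x ∈ M, ∀ y ∈ L, P A B c x y = 0 := by
      intro c hc x hx y hy
      rw [hM, Submodule.mem_dualCoannihilator, hD, hmapeq e c he0 hc] at hx
      rw [hskew, hx _ ⟨y, hy, rfl⟩, neg_zero]
    obtain ⟨K, hK⟩ := Submodule.exists_isCompl L
    set N := K ⊓ M with hN
    have hsup : L ⊔ N = M := by
      rw [hN, ← sup_inf_assoc_of_le K hLM, hK.sup_eq_top, top_inf_eq]
    have hkeyN : ∀ c, c ≠ 0 → ∀ x ∈ N, (∀ y ∈ N, P A B c x y = 0) → x = 0 := by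
      intro c hc x hx h
      have hxL : x ∈ L := by
        refine hkey c hc x hx.2 ?_
        intro y hy
        rw [← hsup] at hy
        obtain ⟨y1, h1, y2, h2, rfl⟩ := Submodule.mem_sup.mp hy
        rw [map_add, hMperp c hc x hx.2 y1 h1, h y2 h2, add_zero]
      exact (Submodule.disjoint_def.mp hK.disjoint) x hxL hx.1
    have hN0 : N = ⊥ := by
      by_contra hne
      have : Nontrivial N := Submodule.nontrivial_iff_ne_bot.mpr hne
      let R : (V →ₗ[ℂ] V →ₗ[ℂ] ℂ) → (N →ₗ[ℂ] Dual ℂ N) := fun C => C.domRestrict₁₂ N N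
      have hinj : Function.Injective (R A) := by
        rw [← LinearMap.ker_eq_bot, Submodule.eq_bot_iff]
        intro x hx
        have := hkeyN (1, 0) (by simp) x x.2 (fun y hy => by
          have := LinearMap.congr_fun (LinearMap.mem_ker.mp hx) ⟨y, hy⟩
          have h3 : A x y = 0 := this
          simpa [P] using h3)
        exact Subtype.ext this
      let E : N ≃ₗ[ℂ] Dual ℂ N := LinearEquiv.ofInjectiveOfFinrankEq (R A) hinj
        (Subspace.dual_finrank_eq).symm
      have hE : ∀ x, E x = R A x := fun x => rfl
      obtain ⟨s, hs⟩ := Module.End.exists_eigenvalue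
        (E.symm.toLinearMap ∘ₗ (R B) : Module.End ℂ N)
      obtain ⟨x, hx⟩ := hs.exists_hasEigenvector
      have h1 := hx.apply_eq_smul
      have h2 : R B x = s • R A x := by
        rw [LinearMap.comp_apply, LinearEquiv.coe_coe, LinearEquiv.symm_apply_eq, map_smul] at h1
        exact h1
      apply hx.2
      apply Subtype.ext
      refine hkeyN (-s, 1) (by simp) x x.2 ?_
      intro y hy
      have := LinearMap.congr_fun h2 ⟨y, hy⟩
      have h3 : B x y = s * A x y := this
      simp [P, h3]
    have hML : M = L := by rw [← hsup, hN0, sup_bot_eq]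
    rw [hML] at hDM
    have h1 := hkd e he0
    have h2 := hdim e L
    have h5 : finrank ℂ L.dualAnnihilator = finrank ℂ V - finrank ℂ L := by omega
    rw [hDM] at h5
    have h6 : finrank ℂ (L.map (P A B e)) = finrank ℂ V - finrank ℂ L := h5
    have h7 := Submodule.finrank_le L
    omega

end Bols

/-- Pointwise form of Bolsinov's completeness criterion for a pencil of alternating
bilinear forms `λA + μB` on a finite-dimensional complex vector space: with
`r = max rank(λA + μB)` and `L` the span of the kernels of the forms of maximal rank `r`
in the pencil, one has `dim L = dim V − r/2` (stated as `2·dim L + r = 2·dim V`) if and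
only if every nonzero form `λA + μB` of the pencil has rank exactly `r`. -/
theorem bolsinov_completeness_criterion
    {V : Type*} [AddCommGroup V] [Module ℂ V] [FiniteDimensional ℂ V]
    (A B : V →ₗ[ℂ] V →ₗ[ℂ] ℂ)
    (hA : ∀ v : V, A v v = 0) (hB : ∀ v : V, B v v = 0)
    (r : ℕ)
    (hr : ∀ l m : ℂ, finrank ℂ (LinearMap.range (l • A + m • B)) ≤ r)
    (hex : ∃ l m : ℂ, finrank ℂ (LinearMap.range (l • A + m • B)) = r)
    (L : Submodule ℂ V)
    (hL : L = ⨆ (c : ℂ × ℂ) (_ : finrank ℂ (LinearMap.range (c.1 • A + c.2 • B)) = r),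
        LinearMap.ker (c.1 • A + c.2 • B)) :
    (2 * finrank ℂ L + r = 2 * finrank ℂ V) ↔
      (∀ l m : ℂ, (l, m) ≠ (0, 0) →
        finrank ℂ (LinearMap.range (l • A + m • B)) = r) := by
  by_cases hr0 : r = 0
  · subst hr0
    have h0 : ∀ l m : ℂ, finrank ℂ (LinearMap.range (l • A + m • B)) = 0 :=
      fun l m => Nat.le_zero.mp (hr l m)
    have hT : L = ⊤ := by
      rw [hL, eq_top_iff]
      refine le_iSup₂_of_le (0, 0) (h0 _ _) ?_
      simp
    constructor
    · intro _ l m _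
      exact h0 l m
    · intro _
      rw [hT]
      simp
  · obtain ⟨l, m, hlm⟩ := hex
    rw [Bols.main A B hA hB r hr0 (fun c => hr c.1 c.2) ⟨(l, m), hlm⟩ L hL]
    exact ⟨fun h l m hne => h (l, m) hne, fun h c hc => h c.1 c.2 hc⟩
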